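/- arXiv:1811.08238 — 2 statements merged into one kernel-verified Lean document; each statement's English description precedes it below -/
import Mathlib

section
/- Let k ≥ 1 be a natural number, let n_1, …, n_k be positive real numbers, and let c > 0 be a real number. Suppose that (i) ∑_{i=1}^k n_i ≤ 1, and (ii) for every j with 1 ≤ j ≤ k one has ∑_{i=1}^j n_i · 2^{i-1} ≥ 2^{j-1}/c. Then c ≥ (k+1)/2. -/
/-- Summation by parts against the weights `2 ^ (i - 1)`. -/
theorem sum_Icc_eq_weighted_partial_sums (n : ℕ → ℝ) (m : ℕ) :
    ∑ i ∈ Finset.Icc 1 m, n i =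
      (∑ i ∈ Finset.Icc 1 m, n i * 2 ^ (i - 1)) / 2 ^ m +
        ∑ j ∈ Finset.Icc 1 m, (∑ i ∈ Finset.Icc 1 j, n i * 2 ^ (i - 1)) / 2 ^ j := by
  induction m with
  | zero => simp
  | succ m ih =>
    simp only [Finset.sum_Icc_succ_top (Nat.le_add_left 1 m), ih, Nat.add_sub_cancel]
    field_simp
    ring

/-- Lemma 4 (algebraic fact): if positive reals `n 1, …, n k` satisfy
`∑_{i=1}^k n i ≤ 1` and `∑_{i=1}^j n i · 2^(i-1) ≥ 2^(j-1)/c` for all `1 ≤ j ≤ k`,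
then `c ≥ (k+1)/2`. -/
theorem stmt_0 (k : ℕ) (hk : 1 ≤ k) (n : ℕ → ℝ) (c : ℝ) (hc : 0 < c)
    (hpos : ∀ i ∈ Finset.Icc 1 k, 0 < n i)
    (hsum : ∑ i ∈ Finset.Icc 1 k, n i ≤ 1)
    (hlb : ∀ j ∈ Finset.Icc 1 k,
      ∑ i ∈ Finset.Icc 1 j, n i * 2 ^ (i - 1) ≥ (2 : ℝ) ^ (j - 1) / c) :
    c ≥ ((k : ℝ) + 1) / 2 := by
  have hterm : ∀ j ∈ Finset.Icc 1 k,
      1 / (2 * c) ≤ (∑ i ∈ Finset.Icc 1 j, n i * 2 ^ (i - 1)) / 2 ^ j := by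
    intro j hj
    obtain ⟨l, rfl⟩ := Nat.exists_eq_add_of_le' (Finset.mem_Icc.mp hj).1
    have h := hlb _ hj
    rw [Nat.add_sub_cancel] at h
    rw [le_div_iff₀ (by positivity)]
    calc 1 / (2 * c) * 2 ^ (l + 1) = 2 ^ l / c := by field_simp; ring
      _ ≤ _ := h
  have hlast := hterm k (Finset.mem_Icc.mpr ⟨hk, le_rfl⟩)
  have hall := Finset.card_nsmul_le_sum _ _ _ hterm
  rw [Nat.card_Icc, Nat.add_sub_cancel, nsmul_eq_mul] at hall
  rw [sum_Icc_eq_weighted_partial_sums] at hsum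
  have h : ((k : ℝ) + 1) / (2 * c) ≤ 1 := by
    calc ((k : ℝ) + 1) / (2 * c) = 1 / (2 * c) + k * (1 / (2 * c)) := by ring
      _ ≤ 1 := by linarith
  rw [div_le_one (by positivity)] at h
  linarith
end

section
/- Let k ≥ 1 be a natural number, let n_1, …, n_k be real numbers, and let c > 0 be a real number. Suppose that for every j with 1 ≤ j ≤ k one has ∑_{i=1}^j n_i · 2^{i-1} ≥ 2^{j-1}/c. Then ∑_{i=1}^k n_i · 2^{k-1} ≥ (k+1) · 2^{k-2} / c. -/
/-- If the partial sums weighted by `2 ^ (i - 1)` are bounded below geometrically, then the uniformly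
weighted sum exceeds the geometrically weighted one by at least `m * 2 ^ (m - 1) / c`. -/
theorem uniform_sum_sub_geometric_sum_ge (n : ℕ → ℝ) (c : ℝ) (m : ℕ)
    (hlb : ∀ j ∈ Finset.Icc 1 m,
      ∑ i ∈ Finset.Icc 1 j, n i * 2 ^ (i - 1) ≥ (2 : ℝ) ^ (j - 1) / c) :
    (m : ℝ) * (2 ^ m / 2 / c) ≤
      ∑ i ∈ Finset.Icc 1 (m + 1), n i * 2 ^ m -
        ∑ i ∈ Finset.Icc 1 (m + 1), n i * 2 ^ (i - 1) := by
  induction m with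
  | zero => simp
  | succ m ih =>
    have ih' := ih fun j hj =>
      hlb j (Finset.Icc_subset_Icc_right (Nat.le_succ m) hj)
    have hS := hlb (m + 1) (by simp)
    rw [Finset.sum_Icc_succ_top (by omega : 1 ≤ m + 1 + 1),
      Finset.sum_Icc_succ_top (by omega : 1 ≤ m + 1 + 1)]
    simp only [Nat.add_sub_cancel] at hS ⊢
    have hT : ∑ i ∈ Finset.Icc 1 (m + 1), n i * 2 ^ (m + 1) =
        2 * ∑ i ∈ Finset.Icc 1 (m + 1), n i * 2 ^ m := by
      rw [Finset.mul_sum]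
      exact Finset.sum_congr rfl fun i _ => by ring
    have hL : ((m + 1 : ℕ) : ℝ) * (2 ^ (m + 1) / 2 / c) =
        2 * ((m : ℝ) * (2 ^ m / 2 / c)) + 2 ^ m / c := by
      push_cast
      ring
    rw [hT, hL]
    linarith

/-- Weighted-sum step in the proof of the algebraic fact (Lemma 4). -/
theorem stmt_1 (k : ℕ) (hk : 1 ≤ k) (n : ℕ → ℝ) (c : ℝ) (hc : 0 < c)
    (hlb : ∀ j ∈ Finset.Icc 1 k,
      ∑ i ∈ Finset.Icc 1 j, n i * 2 ^ (i - 1) ≥ (2 : ℝ) ^ (j - 1) / c) :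
    ∑ i ∈ Finset.Icc 1 k, n i * 2 ^ (k - 1) ≥
      ((k : ℝ) + 1) * (2 : ℝ) ^ ((k : ℤ) - 2) / c := by
  obtain ⟨m, rfl⟩ : ∃ m, k = m + 1 := ⟨k - 1, by omega⟩
  have hdiff := uniform_sum_sub_geometric_sum_ge n c m fun j hj =>
    hlb j (Finset.Icc_subset_Icc_right (Nat.le_succ m) hj)
  have hS := hlb (m + 1) (by simp)
  have hpow : (2 : ℝ) ^ (((m + 1 : ℕ) : ℤ) - 2) = 2 ^ m / 2 := by
    rw [show ((m + 1 : ℕ) : ℤ) - 2 = (m : ℤ) - 1 by push_cast; ring,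
      zpow_sub_one₀ two_ne_zero, zpow_natCast, div_eq_mul_inv]
  have hL : (((m + 1 : ℕ) : ℝ) + 1) * (2 ^ m / 2) / c =
      (m : ℝ) * (2 ^ m / 2 / c) + 2 ^ m / c := by
    push_cast
    ring
  simp only [Nat.add_sub_cancel] at hS ⊢
  rw [hpow, hL]
  linarith
end
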